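/- Let G = (V, E, (V_0, V_1, V_r)) be a 2½-player game graph and 𝒫̂ = (B̂_1, …, B̂_ℓ) a parity partition of V with ℓ even. Then every vertex in the parity fixpoint νY_ℓ. μX_{ℓ−1}. ⋯ μX_3. νY_2. μX_1. ⋃_{odd i ∈ {1,…,ℓ−1}} (B̂_i ∩ Apre(Y_{i+1}, X_i)) ∪ ⋃_{even j ∈ {2,…,ℓ}} (B̂_j ∩ Cpre(Y_j)) is almost-surely winning for Player 0 for Parity(𝒫̂): there exists π_0 ∈ Π_0 such that for all π_1 ∈ Π_1, P_v^{π_0,π_1}(Parity(𝒫̂)) = 1. -/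

import Mathlib

open MeasureTheory
open scoped ENNReal

/-- A 2½-player game graph: a finite set of vertices `V`, an edge relation `E`, and a
partition of `V` into Player-0 vertices `V0`, Player-1 vertices `V1` and random vertices
`Vr` (the partition and nonemptiness conditions are stated via `IsGameGraph`). -/
structure GameGraph (V : Type*) where
  E : V → Set V
  V0 : Set V
  V1 : Set V
  Vr : Set V

/-- The defining conditions of a 2½-player game graph: every vertex has a successor and
`(V0, V1, Vr)` is a partition of `V`. -/
def GameGraph.IsGameGraph {V : Type*} (G : GameGraph V) : Prop :=
  (∀ v, (G.E v).Nonempty) ∧ G.V0 ∪ G.V1 ∪ G.Vr = Set.univ ∧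
    Disjoint G.V0 G.V1 ∧ Disjoint G.V0 G.Vr ∧ Disjoint G.V1 G.Vr

/-- A (randomized, history-dependent) strategy: it assigns to every history `h ∈ V*` and
current vertex `v` a probability distribution supported on the successors `E(v)`. -/
def IsStrategy {V : Type*} (G : GameGraph V) (σ : List V → V → PMF V) : Prop :=
  ∀ (h : List V) (v : V), (σ h v).support ⊆ G.E v

/-- Deterministic memoryless strategies. -/
def IsDM {V : Type*} (σ : List V → V → PMF V) : Prop :=
  ∃ f : V → V, ∀ (h : List V) (v : V), σ h v = PMF.pure (f v)

open scoped Classical in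
/-- One-step transition probability: at a Player-0 vertex `π0` moves, at a Player-1 vertex
`π1` moves, and at a random vertex the successor is drawn uniformly at random from `E(v)`. -/
noncomputable def stepProb {V : Type*} (G : GameGraph V)
    (π0 π1 : List V → V → PMF V) (h : List V) (v x : V) : ℝ≥0∞ :=
  if v ∈ G.V0 then π0 h v x
  else if v ∈ G.V1 then π1 h v x
  else if x ∈ G.E v then ((G.E v).ncard : ℝ≥0∞)⁻¹ else 0

/-- Probability that, starting at vertex `v` with past history `h`, the run continues with
the finite sequence of vertices `l`. -/
noncomputable def extProb {V : Type*} (G : GameGraph V)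
    (π0 π1 : List V → V → PMF V) : List V → V → List V → ℝ≥0∞
  | _, _, [] => 1
  | h, v, x :: rest => stepProb G π0 π1 h v x * extProb G π0 π1 (h ++ [v]) x rest

open scoped Classical in
/-- Probability that the run started at `v` begins with the finite sequence `l`. -/
noncomputable def prefixProb {V : Type*} (G : GameGraph V)
    (π0 π1 : List V → V → PMF V) (v : V) : List V → ℝ≥0∞
  | [] => 1
  | x :: rest => if x = v then extProb G π0 π1 [] v rest else 0

/-- The cylinder set of runs beginning with the finite word `l`. -/
def cyl {V : Type*} (l : List V) : Set (ℕ → V) :=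
  {r | ∀ i : Fin l.length, r i = l.get i}

/-- `P` is the probability measure `P_v^{π0,π1}` on the run space `V^ℕ` (obtained by the
Ionescu–Tulcea construction): it is a probability measure whose cylinder probabilities are
the finite-run probabilities determined by `π0`, `π1` and the uniform choices at random
vertices. -/
def IsRunMeasure {V : Type*} [MeasurableSpace V] (G : GameGraph V)
    (π0 π1 : List V → V → PMF V) (v : V) (P : Measure (ℕ → V)) : Prop :=
  IsProbabilityMeasure P ∧ ∀ l : List V, P (cyl l) = prefixProb G π0 π1 v l

/-- Controllable predecessor. -/
def Cpre {V : Type*} (G : GameGraph V) (C : Set V) : Set V :=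
  {v ∈ G.V0 | (G.E v ∩ C).Nonempty} ∪ {v ∈ G.V1 ∪ G.Vr | G.E v ⊆ C}

/-- Almost-sure predecessor. -/
def Apre {V : Type*} (G : GameGraph V) (C D : Set V) : Set V :=
  Cpre G D ∪ {v ∈ G.Vr | G.E v ⊆ C ∧ (G.E v ∩ D).Nonempty}

/-- Least fixed point (Knaster–Tarski) of an operator on sets of vertices. -/
def lfpSet {V : Type*} (f : Set V → Set V) : Set V := sInf {A | f A ⊆ A}

/-- Greatest fixed point (Knaster–Tarski) of an operator on sets of vertices. -/
def gfpSet {V : Type*} (f : Set V → Set V) : Set V := sSup {A | A ⊆ f A}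

/-- The body of the parity fixpoint:
`⋃_{odd i ∈ {1,…,ℓ−1}} (B_i ∩ Apre(Y_{i+1}, X_i)) ∪ ⋃_{even j ∈ {2,…,ℓ}} (B_j ∩ Cpre(Y_j))`. -/
def parityBody {V : Type*} (G : GameGraph V) (ℓ : ℕ) (B : ℕ → Set V)
    (Y X : ℕ → Set V) : Set V :=
  (⋃ i ∈ Finset.Icc 1 (ℓ - 1), ⋃ (_ : Odd i), B i ∩ Apre G (Y (i + 1)) (X i)) ∪
  (⋃ j ∈ Finset.Icc 2 ℓ, ⋃ (_ : Even j), B j ∩ Cpre G (Y j))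

/-- The nested parity fixpoint, peeling the variable pairs from the outside in:
`paritySolve m` computes `νY_{2m}. μX_{2m−1}. ⋯ νY_2. μX_1. parityBody` with the remaining
variables taken from the ambient assignments `Y, X`. -/
def paritySolve {V : Type*} (G : GameGraph V) (ℓ : ℕ) (B : ℕ → Set V) :
    ℕ → (ℕ → Set V) → (ℕ → Set V) → Set V
  | 0, Y, X => parityBody G ℓ B Y X
  | m + 1, Y, X =>
    gfpSet fun Yv => lfpSet fun Xv =>
      paritySolve G ℓ B m (Function.update Y (2 * (m + 1)) Yv)
        (Function.update X (2 * m + 1) Xv)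

/-- The full parity fixpoint
`νY_ℓ. μX_{ℓ−1}. ⋯ μX_3. νY_2. μX_1. ⋃_{odd i} (B_i ∩ Apre(Y_{i+1}, X_i)) ∪
⋃_{even j} (B_j ∩ Cpre(Y_j))` (for `ℓ` even, there are `ℓ/2` nested variable pairs and all
variables occurring in the body are bound). -/
def parityFixpoint {V : Type*} (G : GameGraph V) (ℓ : ℕ) (B : ℕ → Set V) : Set V :=
  paritySolve G ℓ B (ℓ / 2) (fun _ => ∅) (fun _ => ∅)

/-- The parity winning condition `Parity(𝒫̂)` on runs. -/
def parityEvent {V : Type*} (ℓ : ℕ) (B : ℕ → Set V) : Set (ℕ → V) :=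
  {r | ∀ i ∈ Finset.Icc 1 ℓ, Odd i → {k | r k ∈ B i}.Infinite →
    ∃ j ∈ Finset.Icc (i + 1) ℓ, Even j ∧ {k | r k ∈ B j}.Infinite}


section Helpers

theorem gfpSet_mono {V : Type*} {f g : Set V → Set V} (h : ∀ A, f A ⊆ g A) :
    gfpSet f ⊆ gfpSet g :=
  sSup_le_sSup fun A (hA : A ⊆ f A) => hA.trans (h A)

theorem lfpSet_mono {V : Type*} {f g : Set V → Set V} (h : ∀ A, f A ⊆ g A) :
    lfpSet f ⊆ lfpSet g :=
  sInf_le_sInf fun A (hA : g A ⊆ A) => (h A).trans hA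

theorem gfpSet_fixed {V : Type*} {f : Set V → Set V} (hf : Monotone f) :
    gfpSet f = f (gfpSet f) := by
  have h1 : gfpSet f ⊆ f (gfpSet f) := by
    apply sSup_le
    intro A hA
    exact le_trans hA (hf (le_sSup hA))
  exact Set.Subset.antisymm h1 (le_sSup (show f (gfpSet f) ⊆ f (f (gfpSet f)) from hf h1))

theorem lfpSet_fixed_le {V : Type*} {f : Set V → Set V} (hf : Monotone f) :
    f (lfpSet f) ⊆ lfpSet f := by
  apply le_sInf
  intro A hA
  exact le_trans (hf (sInf_le hA)) hA

theorem iterate_le_lfpSet {V : Type*} {f : Set V → Set V} (hf : Monotone f) (k : ℕ) :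
    f^[k] ∅ ⊆ lfpSet f := by
  induction k with
  | zero => simp
  | succ k ih =>
    rw [Function.iterate_succ_apply']
    exact (hf ih).trans (lfpSet_fixed_le hf)

theorem iterate_mono {V : Type*} {f : Set V → Set V} (hf : Monotone f) :
    Monotone (fun k => f^[k] (∅ : Set V)) :=
  hf.monotone_iterate_of_le_map (Set.empty_subset _)

theorem lfpSet_le_iterate {V : Type*} [Finite V] {f : Set V → Set V} (hf : Monotone f) :
    ∃ k, lfpSet f ⊆ f^[k] ∅ := by
  obtain ⟨n, hn⟩ := WellFoundedGT.monotone_chain_condition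
    (⟨fun k => f^[k] (∅ : Set V), iterate_mono hf⟩ : ℕ →o Set V)
  refine ⟨n, sInf_le ?_⟩
  have := hn (n+1) (Nat.le_succ n)
  simp only [OrderHom.coe_mk, Function.iterate_succ_apply'] at this
  exact this.symm.le

theorem Cpre_mono {V : Type*} (G : GameGraph V) {C D : Set V} (h : C ⊆ D) :
    Cpre G C ⊆ Cpre G D := by
  rintro v (⟨h0, x, hx, hx'⟩ | ⟨h0, h1⟩)
  · exact Or.inl ⟨h0, x, hx, h hx'⟩
  · exact Or.inr ⟨h0, h1.trans h⟩

theorem Apre_mono {V : Type*} (G : GameGraph V) {C D C' D' : Set V} (h : C ⊆ C') (h' : D ⊆ D') :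
    Apre G C D ⊆ Apre G C' D' := by
  rintro v (h0 | ⟨h0, h1, x, hx, hx'⟩)
  · exact Or.inl (Cpre_mono G h' h0)
  · exact Or.inr ⟨h0, h1.trans h, x, hx, h' hx'⟩

theorem mem_parityBody {V : Type*} (G : GameGraph V) (ℓ : ℕ) (B : ℕ → Set V)
    (Y X : ℕ → Set V) (v : V) : v ∈ parityBody G ℓ B Y X ↔
      (∃ i, (1 ≤ i ∧ i ≤ ℓ - 1) ∧ Odd i ∧ v ∈ B i ∧ v ∈ Apre G (Y (i+1)) (X i)) ∨
      (∃ j, (2 ≤ j ∧ j ≤ ℓ) ∧ Even j ∧ v ∈ B j ∧ v ∈ Cpre G (Y j)) := by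
  simp only [parityBody, Set.mem_union, Set.mem_iUnion, Finset.mem_Icc, Set.mem_inter_iff,
    exists_prop]

theorem parityBody_mono {V : Type*} (G : GameGraph V) (ℓ : ℕ) (B : ℕ → Set V)
    {Y X Y' X' : ℕ → Set V} (hY : ∀ j, Even j → Y j ⊆ Y' j) (hX : ∀ i, Odd i → X i ⊆ X' i) :
    parityBody G ℓ B Y X ⊆ parityBody G ℓ B Y' X' := by
  intro v
  rw [mem_parityBody, mem_parityBody]
  rintro (⟨i, h1, h2, h3, h4⟩ | ⟨j, h1, h2, h3, h4⟩)
  · exact Or.inl ⟨i, h1, h2, h3, Apre_mono G (hY _ h2.add_one) (hX _ h2) h4⟩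
  · exact Or.inr ⟨j, h1, h2, h3, Cpre_mono G (hY _ h2) h4⟩

theorem update_mono' {V : Type*} {Y Y' : ℕ → Set V} (hY : ∀ j, Y j ⊆ Y' j) {A A' : Set V}
    (hA : A ⊆ A') (n : ℕ) : ∀ j, Function.update Y n A j ⊆ Function.update Y' n A' j := by
  intro j
  by_cases h : j = n
  · subst h; simpa using hA
  · simpa [Function.update_of_ne h] using hY j

theorem paritySolve_mono {V : Type*} (G : GameGraph V) (ℓ : ℕ) (B : ℕ → Set V) (m : ℕ) :
    ∀ {Y X Y' X' : ℕ → Set V}, (∀ j, Y j ⊆ Y' j) → (∀ i, X i ⊆ X' i) →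
    paritySolve G ℓ B m Y X ⊆ paritySolve G ℓ B m Y' X' := by
  induction m with
  | zero =>
    intro Y X Y' X' hY hX
    exact parityBody_mono G ℓ B (fun j _ => hY j) (fun i _ => hX i)
  | succ m ih =>
    intro Y X Y' X' hY hX
    exact gfpSet_mono fun A => lfpSet_mono fun C =>
      ih (update_mono' hY subset_rfl _) (update_mono' hX subset_rfl _)

/-- Ranked replacement of the `Y` variables. -/
def certY {V : Type*} (m : ℕ) (Y : ℕ → Set V) (S : Set V) (ρ : ℕ → V → ℕ) (v : V) : ℕ → Set V :=
  fun j => if j ≤ 2 * m then {w | w ∈ S ∧ ∀ i, j ≤ i → ρ i w ≤ ρ i v} else Y j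

/-- Ranked replacement of the `X` variables. -/
def certX {V : Type*} (m : ℕ) (X : ℕ → Set V) (S : Set V) (ρ : ℕ → V → ℕ) (v : V) : ℕ → Set V :=
  fun j => if j ≤ 2 * m then {w | w ∈ S ∧ (∀ i, j < i → ρ i w ≤ ρ i v) ∧ ρ j w < ρ j v} else X j

theorem lex_lt {K K' g g' N : ℕ} (hg : g' < N) (h : K' < K) : K' * N + g' < K * N + g := by
  have : (K' + 1) * N ≤ K * N := Nat.mul_le_mul_right _ h
  nlinarith

theorem cert_exists {V : Type*} [Finite V] (G : GameGraph V) (ℓ : ℕ) (B : ℕ → Set V) (m : ℕ) :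
    ∀ (Y X : ℕ → Set V), ∃ ρ : ℕ → V → ℕ, ∀ v ∈ paritySolve G ℓ B m Y X,
      v ∈ parityBody G ℓ B (certY m Y (paritySolve G ℓ B m Y X) ρ v)
        (certX m X (paritySolve G ℓ B m Y X) ρ v) := by
  induction m with
  | zero =>
    intro Y X
    refine ⟨fun _ _ => 0, fun v hv => ?_⟩
    change v ∈ parityBody G ℓ B Y X at hv
    rw [mem_parityBody] at hv ⊢
    rcases hv with ⟨i, h1, h2, h3, h4⟩ | ⟨j, h1, h2, h3, h4⟩
    · refine Or.inl ⟨i, h1, h2, h3, ?_⟩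
      have : ¬ i = 0 := by omega
      simpa [certY, certX, this] using h4
    · refine Or.inr ⟨j, h1, h2, h3, ?_⟩
      have : ¬ j = 0 := by omega
      simpa [certY, this] using h4
  | succ m ih =>
    intro Y X
    have := Fintype.ofFinite V
    set S := paritySolve G ℓ B (m+1) Y X with hSdef
    let F : Set V → Set V → Set V := fun Yv Xv =>
      paritySolve G ℓ B m (Function.update Y (2 * (m + 1)) Yv) (Function.update X (2 * m + 1) Xv)
    have hF2 : ∀ A, Monotone (F A) := fun A C C' hC =>
      paritySolve_mono G ℓ B m (fun j => subset_rfl) (update_mono' (fun j => subset_rfl) hC _)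
    have hF1 : Monotone (fun A => lfpSet (F A)) := fun A A' hA =>
      lfpSet_mono fun C =>
        paritySolve_mono G ℓ B m (update_mono' (fun j => subset_rfl) hA _) (fun j => subset_rfl)
    have hS : S = lfpSet (F S) := gfpSet_fixed hF1
    let a : ℕ → Set V := fun k => (F S)^[k] ∅
    have ha0 : a 0 = ∅ := rfl
    have haS : ∀ k, a k ⊆ S := fun k => by
      have := iterate_le_lfpSet (hF2 S) k
      rwa [← hS] at this
    have hamono : Monotone a := iterate_mono (hF2 S)
    have hasucc : ∀ k, a (k+1) = F S (a k) := fun k => Function.iterate_succ_apply' _ _ _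
    obtain ⟨n, hn⟩ := lfpSet_le_iterate (hF2 S)
    rw [← hS] at hn
    have hex : ∀ v ∈ S, {k | v ∈ a (k+1)}.Nonempty := fun v hv =>
      ⟨n, hamono (Nat.le_succ n) (hn hv)⟩
    let K : V → ℕ := fun v => sInf {k | v ∈ a (k+1)}
    have hK1 : ∀ v ∈ S, v ∈ a (K v + 1) := fun v hv => Nat.sInf_mem (hex v hv)
    have hK2 : ∀ v k, v ∈ a (k+1) → K v ≤ k := fun v k h => Nat.sInf_le h
    have hK3 : ∀ v k, v ∈ a k → K v < k := by
      intro v k h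
      cases k with
      | zero => rw [ha0] at h; exact h.elim
      | succ k => exact Nat.lt_succ_of_le (hK2 v k h)
    choose ρ' hρ' using fun k =>
      ih (Function.update Y (2 * (m + 1)) S) (Function.update X (2 * m + 1) (a k))
    have hρ'' : ∀ k, ∀ v ∈ a (k+1), v ∈ parityBody G ℓ B
        (certY m (Function.update Y (2 * (m + 1)) S) (a (k+1)) (ρ' k) v)
        (certX m (Function.update X (2 * m + 1) (a k)) (a (k+1)) (ρ' k) v) := by
      intro k v hv
      rw [hasucc] at hv ⊢
      exact hρ' k v hv
    let g : ℕ → V → ℕ := fun i v => ρ' (K v) i v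
    let N : ℕ → ℕ := fun i => 1 + ∑ v, g i v
    have hgN : ∀ i v, g i v < N i := fun i v => by
      have := Finset.single_le_sum (f := g i) (fun x _ => Nat.zero_le _) (Finset.mem_univ v)
      simp only [N]; omega
    let ρ : ℕ → V → ℕ := fun i v =>
      if i ≤ 2 * m then K v * N i + g i v else if i = 2 * m + 1 then K v else 0
    have key_le : ∀ v w i, w ∈ a (K v + 1) → (i ≤ 2 * m → ρ' (K v) i w ≤ ρ' (K v) i v) →
        ρ i w ≤ ρ i v := by
      intro v w i hw h
      have hKw := hK2 w _ hw
      simp only [ρ]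
      split_ifs with h1 h2
      · rcases hKw.lt_or_eq with hlt | heq
        · exact (lex_lt (hgN i w) hlt).le
        · have := h h1
          simp only [g, heq]; omega
      · exact hKw
      · exact le_rfl
    have key_lt : ∀ v w i, w ∈ a (K v + 1) → i ≤ 2 * m → ρ' (K v) i w < ρ' (K v) i v →
        ρ i w < ρ i v := by
      intro v w i hw h1 h
      have hKw := hK2 w _ hw
      simp only [ρ, if_pos h1]
      rcases hKw.lt_or_eq with hlt | heq
      · exact lex_lt (hgN i w) hlt
      · simp only [g, heq]; omega
    refine ⟨ρ, fun v hv => ?_⟩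
    refine parityBody_mono G ℓ B ?_ ?_ (hρ'' (K v) v (hK1 v hv))
    · intro j hj w hw
      simp only [certY] at hw ⊢
      by_cases h1 : j ≤ 2 * m
      · rw [if_pos h1] at hw
        rw [if_pos (by omega)]
        exact ⟨haS _ hw.1, fun i hi => key_le v w i hw.1 fun _ => hw.2 i hi⟩
      · rw [if_neg h1] at hw
        by_cases h2 : j = 2 * (m + 1)
        · subst h2
          rw [Function.update_self] at hw
          rw [if_pos le_rfl]
          refine ⟨hw, fun i hi => ?_⟩
          simp only [ρ]
          rw [if_neg (by omega), if_neg (by omega), if_neg (by omega), if_neg (by omega)]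
        · rw [Function.update_of_ne h2] at hw
          obtain ⟨t, ht⟩ := hj
          rw [if_neg (by omega)]
          exact hw
    · intro j hj w hw
      simp only [certX] at hw ⊢
      by_cases h1 : j ≤ 2 * m
      · rw [if_pos h1] at hw
        rw [if_pos (by omega)]
        exact ⟨haS _ hw.1, fun i hi => key_le v w i hw.1 fun _ => hw.2.1 i hi,
          key_lt v w j hw.1 h1 hw.2.2⟩
      · rw [if_neg h1] at hw
        by_cases h2 : j = 2 * m + 1
        · subst h2
          rw [Function.update_self] at hw
          rw [if_pos (by omega)]
          refine ⟨haS _ hw, fun i hi => ?_, ?_⟩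
          · simp only [ρ]
            rw [if_neg (by omega), if_neg (by omega), if_neg (by omega), if_neg (by omega)]
          · simp only [ρ]
            rw [if_neg h1, if_neg h1, if_pos trivial, if_pos trivial]
            exact hK3 w _ hw
        · rw [Function.update_of_ne h2] at hw
          obtain ⟨t, ht⟩ := hj
          rw [if_neg (by omega)]
          exact hw

theorem cert_final {V : Type*} [Finite V] (G : GameGraph V) (hG : G.IsGameGraph) (ℓ : ℕ)
    (hℓ : Even ℓ) (B : ℕ → Set V) :
    ∃ ρ : ℕ → V → ℕ, ∀ v ∈ parityFixpoint G ℓ B, ∃ c, (1 ≤ c ∧ c ≤ ℓ) ∧ v ∈ B c ∧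
      (v ∈ G.V0 → ∃ w ∈ G.E v, w ∈ parityFixpoint G ℓ B ∧ (∀ i, c < i → ρ i w ≤ ρ i v) ∧
        (Odd c → ρ c w < ρ c v)) ∧
      (v ∈ G.V1 → ∀ w ∈ G.E v, w ∈ parityFixpoint G ℓ B ∧ (∀ i, c < i → ρ i w ≤ ρ i v) ∧
        (Odd c → ρ c w < ρ c v)) ∧
      (v ∈ G.Vr → (∀ w ∈ G.E v, w ∈ parityFixpoint G ℓ B ∧ (∀ i, c < i → ρ i w ≤ ρ i v)) ∧
        (Odd c → ∃ w ∈ G.E v, ρ c w < ρ c v)) := by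
  obtain ⟨ρ, hρ⟩ := cert_exists G ℓ B (ℓ / 2) (fun _ => ∅) (fun _ => ∅)
  obtain ⟨t, ht⟩ := hℓ
  obtain ⟨hne, -, d1, d2, d3⟩ := hG
  refine ⟨ρ, fun v hv => ?_⟩
  have hv' := hρ v hv
  change v ∈ parityBody G ℓ B (certY (ℓ/2) _ (parityFixpoint G ℓ B) ρ v)
    (certX (ℓ/2) _ (parityFixpoint G ℓ B) ρ v) at hv'
  rw [mem_parityBody] at hv'
  rcases hv' with ⟨i, h1, h2, h3, h4⟩ | ⟨j, h1, h2, h3, h4⟩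
  · refine ⟨i, by omega, h3, ?_⟩
    obtain ⟨s, hs⟩ := h2
    simp only [certY, certX] at h4
    rw [if_pos (by omega), if_pos (by omega)] at h4
    rcases h4 with (⟨h0, x, hx, hx1, hx2, hx3⟩ | ⟨h0, h5⟩) | ⟨h0, h5, x, hx, hx1, hx2, hx3⟩
    · refine ⟨fun _ => ⟨x, hx, hx1, hx2, fun _ => hx3⟩, fun h => ?_, fun h => ?_⟩
      · exact (Set.disjoint_left.1 d1 h0 h).elim
      · exact (Set.disjoint_left.1 d2 h0 h).elim
    · refine ⟨fun h => ?_, fun h w hw => ?_, fun h => ⟨fun w hw => ?_, fun _ => ?_⟩⟩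
      · rcases h0 with h0 | h0
        · exact (Set.disjoint_left.1 d1 h h0).elim
        · exact (Set.disjoint_left.1 d2 h h0).elim
      · exact ⟨(h5 hw).1, (h5 hw).2.1, fun _ => (h5 hw).2.2⟩
      · exact ⟨(h5 hw).1, (h5 hw).2.1⟩
      · obtain ⟨w, hw⟩ := hne v
        exact ⟨w, hw, (h5 hw).2.2⟩
    · refine ⟨fun h => ?_, fun h => ?_, fun h => ⟨fun w hw => ?_, fun _ => ?_⟩⟩
      · exact (Set.disjoint_left.1 d2 h h0).elim
      · exact (Set.disjoint_left.1 d3 h h0).elim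
      · exact ⟨(h5 hw).1, fun i hi => (h5 hw).2 i hi⟩
      · exact ⟨x, hx, hx3⟩
  · refine ⟨j, by omega, h3, ?_⟩
    have hodd : ¬ Odd j := Nat.not_odd_iff_even.2 h2
    simp only [certY] at h4
    rw [if_pos (by omega)] at h4
    rcases h4 with (⟨h0, x, hx, hx1, hx2⟩ | ⟨h0, h5⟩)
    · refine ⟨fun _ => ⟨x, hx, hx1, fun i hi => hx2 i hi.le, fun h => (hodd h).elim⟩,
        fun h => ?_, fun h => ?_⟩
      · exact (Set.disjoint_left.1 d1 h0 h).elim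
      · exact (Set.disjoint_left.1 d2 h0 h).elim
    · refine ⟨fun h => ?_, fun h w hw => ?_, fun h => ⟨fun w hw => ?_, fun h => (hodd h).elim⟩⟩
      · rcases h0 with h0 | h0
        · exact (Set.disjoint_left.1 d1 h h0).elim
        · exact (Set.disjoint_left.1 d2 h h0).elim
      · exact ⟨(h5 hw).1, fun i hi => (h5 hw).2 i hi.le, fun h => (hodd h).elim⟩
      · exact ⟨(h5 hw).1, fun i hi => (h5 hw).2 i hi.le⟩

/-- The deterministic argument: a run which obeys the certificate and is fair at random vertices
satisfies the parity condition. -/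
theorem parity_of_fair {V : Type*} [Finite V] (ℓ : ℕ) (B : ℕ → Set V)
    (hBdisj : ∀ i ∈ Finset.Icc 1 ℓ, ∀ j ∈ Finset.Icc 1 ℓ, i ≠ j → Disjoint (B i) (B j))
    (ρ : ℕ → V → ℕ) (r : ℕ → V) (c : ℕ → ℕ) (hc : ∀ k, (1 ≤ c k ∧ c k ≤ ℓ) ∧ r k ∈ B (c k))
    (hle : ∀ k i, c k < i → ρ i (r (k+1)) ≤ ρ i (r k))
    (hprog : ∀ i u, 1 ≤ i → i ≤ ℓ → Odd i → u ∈ B i → {k | r k = u}.Infinite →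
      {k | r k = u ∧ ρ i (r (k+1)) < ρ i u}.Infinite) :
    r ∈ parityEvent ℓ B := by
  have hcu : ∀ k i, 1 ≤ i → i ≤ ℓ → r k ∈ B i → c k = i := by
    intro k i h1 h2 h3
    by_contra hne
    exact Set.disjoint_left.1 (hBdisj _ (Finset.mem_Icc.2 (hc k).1) i
      (Finset.mem_Icc.2 ⟨h1, h2⟩) hne) (hc k).2 h3
  intro i0 hi0 hodd0 hinf0
  by_contra hcon
  -- the largest colour above `i0` visited infinitely often
  classical
  let T := (Finset.Icc i0 ℓ).filter fun j => {k | r k ∈ B j}.Infinite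
  have hT : T.Nonempty := ⟨i0, by
    simp only [T, Finset.mem_filter, Finset.mem_Icc] at hi0 ⊢
    exact ⟨⟨le_rfl, hi0.2⟩, hinf0⟩⟩
  obtain ⟨i, hiT, himax⟩ := T.exists_max_image id hT
  simp only [T, Finset.mem_filter, Finset.mem_Icc, id] at hiT himax hi0
  have hodd : Odd i := by
    by_contra hev
    rw [Nat.not_odd_iff_even] at hev
    apply hcon
    have : i ≠ i0 := by
      rintro rfl
      exact (Nat.not_odd_iff_even.2 hev) hodd0
    exact ⟨i, Finset.mem_Icc.2 ⟨by omega, by omega⟩, hev, hiT.2⟩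
  -- eventually all colours are at most `i`
  have hev : ∃ n, ∀ k, n ≤ k → c k ≤ i := by
    have hfin : (⋃ j ∈ Finset.Icc (i+1) ℓ, {k | r k ∈ B j}).Finite := by
      apply Set.Finite.biUnion (Finset.finite_toSet _)
      intro j hj
      by_contra hj2
      have hj' := Finset.mem_Icc.1 hj
      have := himax j ⟨⟨by omega, by omega⟩, hj2⟩
      omega
    obtain ⟨n, hn⟩ := hfin.bddAbove
    refine ⟨n+1, fun k hk => ?_⟩
    by_contra hlt
    have : k ≤ n := hn (Set.mem_biUnion (x := c k)
      (Finset.mem_coe.2 (Finset.mem_Icc.2 ⟨by omega, (hc k).1.2⟩)) (hc k).2)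
    omega
  obtain ⟨n, hn⟩ := hev
  -- the vertices of colour `i` visited infinitely often
  have pigeon : ∀ A : Set V, {k | r k ∈ A}.Infinite → ∃ u ∈ A, {k | r k = u}.Infinite := by
    intro A hA
    by_contra hno
    push Not at hno
    apply hA
    have : {k | r k ∈ A} = ⋃ u ∈ A, {k | r k = u} := by ext k; simp
    rw [this]
    exact Set.Finite.biUnion (Set.toFinite _) (fun u hu => hno u hu)
  let Q : Set V := {u | u ∈ B i ∧ {k | r k = u}.Infinite}
  have hQ : Q.Nonempty := by
    obtain ⟨u, hu, hu'⟩ := pigeon (B i) hiT.2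
    exact ⟨u, hu, hu'⟩
  obtain ⟨u, hu, humin⟩ := Set.exists_min_image Q (ρ i) (Set.toFinite _) hQ
  have hp := hprog i u (by omega) (by omega) hodd hu.1 hu.2
  have hlow : {k | r k ∈ {w | w ∈ B i ∧ ρ i w < ρ i u}}.Infinite := by
    rw [Set.infinite_iff_exists_gt]
    intro b
    obtain ⟨k, hk, hkb⟩ := (Set.infinite_iff_exists_gt.1 hp) (max b n)
    have hex : ∃ d, r (k+1+d) ∈ B i := by
      obtain ⟨k', hk', hlt⟩ := (Set.infinite_iff_exists_gt.1 hiT.2) k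
      exact ⟨k' - (k+1), by rw [Nat.add_sub_cancel' hlt]; exact hk'⟩
    have hd := Nat.find_spec hex
    have hd' := fun d' (h : d' < Nat.find hex) => Nat.find_min hex h
    set d := Nat.find hex
    have hmono : ∀ d', d' ≤ d → ρ i (r (k+1+d')) ≤ ρ i (r (k+1)) := by
      intro d'
      induction d' with
      | zero => intro _; exact le_rfl
      | succ d' ih =>
        intro h
        refine le_trans (hle (k+1+d') i ?_) (ih (by omega))
        have h1 := hn (k+1+d') (by omega)
        refine lt_of_le_of_ne h1 fun heq => hd' d' (by omega) ?_
        rw [← heq]; exact (hc _).2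
    exact ⟨k+1+d, ⟨hd, lt_of_le_of_lt (hmono d le_rfl) hk.2⟩, by omega⟩
  obtain ⟨w, hw, hwinf⟩ := pigeon _ hlow
  have := humin w ⟨hw.1, hwinf⟩
  exact absurd hw.2 (by omega)

theorem extProb_append {V : Type*} (G : GameGraph V) (π0 π1 : List V → V → PMF V) (x y : V)
    (rest : List V) : ∀ (h : List V) (v : V),
    extProb G π0 π1 h v (rest ++ [y, x]) =
      extProb G π0 π1 h v (rest ++ [y]) * stepProb G π0 π1 (h ++ v :: rest) y x := by
  induction rest with
  | nil => intro h v; simp [extProb]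
  | cons z rest ih =>
    intro h v
    simp only [List.cons_append, extProb]
    rw [ih]
    simp [mul_assoc]

theorem prefixProb_append {V : Type*} (G : GameGraph V) (π0 π1 : List V → V → PMF V) (v x y : V)
    (h : List V) : prefixProb G π0 π1 v (h ++ [y, x]) =
      prefixProb G π0 π1 v (h ++ [y]) * stepProb G π0 π1 h y x := by
  cases h with
  | nil =>
    by_cases hy : y = v
    · subst hy; simp [prefixProb, extProb]
    · simp [prefixProb, hy]
  | cons z h =>
    by_cases hz : z = v
    · subst hz
      simp only [List.cons_append, prefixProb, if_true]
      rw [extProb_append]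
      simp
    · simp [prefixProb, hz]

theorem mem_cyl_append {V : Type*} (l : List V) (x : V) (r : ℕ → V) :
    r ∈ cyl (l ++ [x]) ↔ r ∈ cyl l ∧ r l.length = x := by
  simp only [cyl, Set.mem_ofPred_eq, List.get_eq_getElem]
  constructor
  · intro h
    refine ⟨fun i => ?_, ?_⟩
    · have := h ⟨i, by simp⟩
      simpa [List.getElem_append_left] using this
    · have := h ⟨l.length, by simp⟩
      simpa using this
  · rintro ⟨h1, h2⟩ ⟨i, hi⟩
    by_cases hil : i < l.length
    · simpa [List.getElem_append_left hil] using h1 ⟨i, hil⟩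
    · have : i = l.length := by simp at hi; omega
      subst this
      simpa using h2

theorem mem_cyl_map {V : Type*} (r : ℕ → V) (n : ℕ) : r ∈ cyl ((List.range n).map r) := by
  intro i
  simp

theorem measurableSet_cyl {V : Type*} [MeasurableSpace V] [MeasurableSingletonClass V]
    (l : List V) : MeasurableSet (cyl l) := by
  have : cyl l = ⋂ i : Fin l.length, (fun r : ℕ → V => r i) ⁻¹' {l.get i} := by
    ext r; simp [cyl]
  rw [this]
  exact MeasurableSet.iInter fun i => measurable_pi_apply _ (measurableSet_singleton _)

/-- Bounded version of: at least `m` visits of `u` from time `n` on, none followed by `w`. -/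
def Ev {V : Type*} (u w : V) : ℕ → ℕ → ℕ → Set (ℕ → V)
  | _, 0, _ => Set.univ
  | 0, _ + 1, _ => ∅
  | K + 1, m + 1, n => {r | (r n = u ∧ r (n+1) ≠ w ∧ r ∈ Ev u w K m (n+1)) ∨
      (r n ≠ u ∧ r ∈ Ev u w K (m+1) (n+1))}

theorem Ev_zero {V : Type*} (u w : V) (K n : ℕ) : Ev u w K 0 n = Set.univ := by
  cases K <;> rfl

theorem Ev_mono {V : Type*} (u w : V) (K : ℕ) : ∀ m n, Ev u w K m n ⊆ Ev u w (K+1) m n := by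
  induction K with
  | zero =>
    intro m n
    cases m with
    | zero => simp [Ev_zero]
    | succ m => exact Set.empty_subset _
  | succ K ih =>
    intro m n
    cases m with
    | zero => simp [Ev_zero]
    | succ m =>
      rintro r (⟨h1, h2, h3⟩ | ⟨h1, h2⟩)
      · exact Or.inl ⟨h1, h2, ih _ _ h3⟩
      · exact Or.inr ⟨h1, ih _ _ h2⟩

theorem mem_Ev {V : Type*} (u w : V) (r : ℕ → V) (hinf : {k | r k = u}.Infinite) (m : ℕ) :
    ∀ n, (∀ k, n ≤ k → r k = u → r (k+1) ≠ w) → ∃ K, r ∈ Ev u w K m n := by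
  induction m with
  | zero => intro n _; exact ⟨0, by simp [Ev_zero]⟩
  | succ m ih =>
    intro n hn
    obtain ⟨k, hk, hkn⟩ := (Set.infinite_iff_exists_gt.1 hinf) n
    have : ∀ d n, (∀ k, n ≤ k → r k = u → r (k+1) ≠ w) → r (n + d) = u →
        ∃ K, r ∈ Ev u w K (m+1) n := by
      intro d
      induction d with
      | zero =>
        intro n hn hd
        obtain ⟨K, hK⟩ := ih (n+1) (fun k hk => hn k (by omega))
        exact ⟨K+1, Or.inl ⟨hd, hn n le_rfl hd, hK⟩⟩
      | succ d ihd =>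
        intro n hn hd
        by_cases hu : r n = u
        · obtain ⟨K, hK⟩ := ih (n+1) (fun k hk => hn k (by omega))
          exact ⟨K+1, Or.inl ⟨hu, hn n le_rfl hu, hK⟩⟩
        · obtain ⟨K, hK⟩ := ihd (n+1) (fun k hk => hn k (by omega))
            (by rw [← hd]; congr 1; omega)
          exact ⟨K+1, Or.inr ⟨hu, hK⟩⟩
    exact this (k - n) n hn (by
      rw [Nat.add_sub_cancel' (le_of_lt hkn)]; exact hk)

theorem cyl_sum {V : Type*} [Fintype V] [MeasurableSpace V] [MeasurableSingletonClass V]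
    (P : Measure (ℕ → V)) (l : List V) : ∑ x, P (cyl (l ++ [x])) = P (cyl l) := by
  have h : cyl l = ⋃ x, cyl (l ++ [x]) := by
    ext r; simp [mem_cyl_append]
  rw [h, measure_iUnion _ (fun x => measurableSet_cyl _), tsum_fintype]
  intro x y hxy
  refine Set.disjoint_left.2 fun r hr hr' => hxy ?_
  rw [mem_cyl_append] at hr hr'
  rw [← hr.2, ← hr'.2]

theorem Ev_bound {V : Type*} [Fintype V] [MeasurableSpace V] [MeasurableSingletonClass V]
    (P : Measure (ℕ → V)) [IsProbabilityMeasure P] (u w : V) (q p : ℝ≥0∞) (hpq : q = 1 - p)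
    (hp : ∀ h : List V, P (cyl (h ++ [u, w])) = P (cyl (h ++ [u])) * p) (K : ℕ) :
    ∀ (m : ℕ) (h : List V) (y : V),
      P (cyl (h ++ [y]) ∩ Ev u w K m h.length) ≤ q ^ m * P (cyl (h ++ [y])) := by
  classical
  induction K with
  | zero =>
    intro m h y
    cases m with
    | zero => simp [Ev_zero]
    | succ m => simp [Ev]
  | succ K ih =>
    intro m h y
    cases m with
    | zero => simp [Ev_zero]
    | succ m =>
      by_cases hy : y = u
      · subst hy
        have hsub : cyl (h ++ [y]) ∩ Ev y w (K+1) (m+1) h.length ⊆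
            ⋃ x ∈ Finset.univ.erase w,
              (cyl ((h ++ [y]) ++ [x]) ∩ Ev y w K m (h ++ [y]).length) := by
          rintro r ⟨hr, hr2⟩
          have hr3 := ((mem_cyl_append _ _ _).1 hr).2
          rcases hr2 with ⟨h1, h2, h3⟩ | ⟨h1, h2⟩
          · refine Set.mem_biUnion (x := r (h.length + 1)) (by simpa using h2) ⟨?_, ?_⟩
            · rw [mem_cyl_append]; exact ⟨hr, by simp⟩
            · simpa using h3
          · exact (h1 hr3).elim
        have hsum : ∑ x ∈ Finset.univ.erase w, P (cyl ((h ++ [y]) ++ [x]))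
            = P (cyl (h ++ [y])) * q := by
          have h1 := cyl_sum P (h ++ [y])
          rw [← Finset.sum_erase_add _ _ (Finset.mem_univ w)] at h1
          have h2 : P (cyl ((h ++ [y]) ++ [w])) = P (cyl (h ++ [y])) * p := by
            rw [← hp h]; simp
          have h3 := ENNReal.eq_sub_of_add_eq (measure_ne_top P _) h1
          rw [h3, h2, hpq, ENNReal.mul_sub (fun _ _ => measure_ne_top P _), mul_one]
        calc _ ≤ _ := measure_mono hsub
          _ ≤ ∑ x ∈ Finset.univ.erase w,
              P (cyl ((h ++ [y]) ++ [x]) ∩ Ev y w K m (h ++ [y]).length) :=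
            measure_biUnion_finset_le _ _
          _ ≤ ∑ x ∈ Finset.univ.erase w, q ^ m * P (cyl ((h ++ [y]) ++ [x])) :=
            Finset.sum_le_sum fun x _ => ih m (h ++ [y]) x
          _ = q ^ (m+1) * P (cyl (h ++ [y])) := by
            rw [← Finset.mul_sum, hsum]; ring
      · have hsub : cyl (h ++ [y]) ∩ Ev u w (K+1) (m+1) h.length ⊆
            ⋃ x ∈ (Finset.univ : Finset V),
              (cyl ((h ++ [y]) ++ [x]) ∩ Ev u w K (m+1) (h ++ [y]).length) := by
          rintro r ⟨hr, hr2⟩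
          have hr3 := ((mem_cyl_append _ _ _).1 hr).2
          rcases hr2 with ⟨h1, h2, h3⟩ | ⟨h1, h2⟩
          · exact (hy (hr3.symm.trans h1)).elim
          · refine Set.mem_biUnion (x := r (h.length + 1)) (by simp) ⟨?_, ?_⟩
            · rw [mem_cyl_append]; exact ⟨hr, by simp⟩
            · simpa using h2
        calc _ ≤ _ := measure_mono hsub
          _ ≤ ∑ x, P (cyl ((h ++ [y]) ++ [x]) ∩ Ev u w K (m+1) (h ++ [y]).length) :=
            measure_biUnion_finset_le _ _
          _ ≤ ∑ x, q ^ (m+1) * P (cyl ((h ++ [y]) ++ [x])) :=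
            Finset.sum_le_sum fun x _ => ih (m+1) (h ++ [y]) x
          _ = q ^ (m+1) * P (cyl (h ++ [y])) := by
            rw [← Finset.mul_sum, cyl_sum]

theorem fair_ae {V : Type*} [Finite V] [MeasurableSpace V] [MeasurableSingletonClass V]
    (P : Measure (ℕ → V)) [IsProbabilityMeasure P] (u w : V) (p : ℝ≥0∞) (hp0 : p ≠ 0)
    (hp : ∀ h : List V, P (cyl (h ++ [u, w])) = P (cyl (h ++ [u])) * p) :
    ∀ᵐ r ∂P, {k | r k = u}.Infinite → {k | r k = u ∧ r (k+1) = w}.Infinite := by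
  have := Fintype.ofFinite V
  have hq : (1 - p) < 1 := ENNReal.sub_lt_self ENNReal.one_ne_top one_ne_zero hp0
  let A : ℕ → Set (ℕ → V) := fun n =>
    {r | {k | r k = u}.Infinite ∧ ∀ k, n ≤ k → r k = u → r (k+1) ≠ w}
  have hA : ∀ n, ∀ (h : List V) (y : V), h.length = n → P (cyl (h ++ [y]) ∩ A n) = 0 := by
    rintro n h y rfl
    have hb : ∀ m, P (cyl (h ++ [y]) ∩ A h.length) ≤ (1 - p) ^ m := by
      intro m
      have hsub : cyl (h ++ [y]) ∩ A h.length ⊆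
          ⋃ K, (cyl (h ++ [y]) ∩ Ev u w K m h.length) := by
        rintro r ⟨hr, hr1, hr2⟩
        obtain ⟨K, hK⟩ := mem_Ev u w r hr1 m _ hr2
        exact Set.mem_iUnion.2 ⟨K, hr, hK⟩
      refine (measure_mono hsub).trans ?_
      have hm : Monotone fun K => cyl (h ++ [y]) ∩ Ev u w K m h.length :=
        monotone_nat_of_le_succ fun K => Set.inter_subset_inter_right _ (Ev_mono u w K m _)
      rw [hm.measure_iUnion]
      refine iSup_le fun K => (Ev_bound P u w _ p rfl hp K m h y).trans ?_
      calc _ ≤ (1 - p) ^ m * 1 := by gcongr; exact prob_le_one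
        _ = _ := mul_one _
    exact le_antisymm (ge_of_tendsto' (ENNReal.tendsto_pow_atTop_nhds_zero_of_lt_one hq) hb)
      (zero_le)
  have hA0 : ∀ n, P (A n) = 0 := by
    intro n
    have hsub : A n ⊆ ⋃ z : {h : List V // h.length = n} × V, (cyl (z.1.1 ++ [z.2]) ∩ A n) := by
      intro r hr
      refine Set.mem_iUnion.2 ⟨⟨⟨(List.range n).map r, by simp⟩, r n⟩, ?_, hr⟩
      rw [mem_cyl_append]
      exact ⟨mem_cyl_map r n, by simp⟩
    exact measure_mono_null hsub (measure_iUnion_null fun z => hA n z.1.1 z.2 z.1.2)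
  have hall : ∀ᵐ r ∂P, ∀ n, r ∉ A n := ae_all_iff.2 fun n => measure_eq_zero_iff_ae_notMem.1 (hA0 n)
  filter_upwards [hall] with r hr hinf
  rw [Set.infinite_iff_exists_gt]
  intro b
  have := hr (b+1)
  simp only [A, Set.mem_ofPred_eq, not_and, not_forall, not_not] at this
  obtain ⟨k, hk, h1, h2⟩ := this hinf
  exact ⟨k, ⟨h1, h2⟩, hk⟩

end Helpers

/-- Let `G` be a 2½-player game graph and `𝒫̂ = (B̂_1, …, B̂_ℓ)` a parity
partition of `V` with `ℓ` even. Then every vertex in the parity fixpoint is almost-surely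
winning for Player 0 for `Parity(𝒫̂)`. -/
theorem stmt6
    {V : Type*} [Finite V] [MeasurableSpace V] [MeasurableSingletonClass V]
    (G : GameGraph V) (hG : G.IsGameGraph)
    (ℓ : ℕ) (hℓ : Even ℓ) (B : ℕ → Set V)
    (hBdisj : ∀ i ∈ Finset.Icc 1 ℓ, ∀ j ∈ Finset.Icc 1 ℓ, i ≠ j → Disjoint (B i) (B j))
    (hBcover : ⋃ i ∈ Finset.Icc 1 ℓ, B i = Set.univ)
    -- the family of run measures `P_v^{π0,π1}` (Ionescu–Tulcea)
    (RunM : (List V → V → PMF V) → (List V → V → PMF V) → V → Measure (ℕ → V))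
    (hRunM : ∀ π0 π1, IsStrategy G π0 → IsStrategy G π1 →
      ∀ v : V, IsRunMeasure G π0 π1 v (RunM π0 π1 v)) :
    ∀ v ∈ parityFixpoint G ℓ B,
      ∃ π0 : List V → V → PMF V, IsStrategy G π0 ∧
        ∀ π1 : List V → V → PMF V, IsStrategy G π1 →
          RunM π0 π1 v (parityEvent ℓ B) = 1 := by
  intro v hv
  classical
  obtain ⟨ρ, hρ⟩ := cert_final G hG ℓ hℓ B
  choose! col hcol using hρ
  set S := parityFixpoint G ℓ B with hSdef
  have hG' := hG
  obtain ⟨hne, hcov, d1, d2, d3⟩ := hG'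
  have hfex : ∀ x, ∃ w ∈ G.E x, x ∈ S → x ∈ G.V0 →
      w ∈ S ∧ (∀ i, col x < i → ρ i w ≤ ρ i x) ∧ (Odd (col x) → ρ (col x) w < ρ (col x) x) := by
    intro x
    by_cases hx : x ∈ S ∧ x ∈ G.V0
    · obtain ⟨w, hw, hw'⟩ := (hcol x hx.1).2.2.1 hx.2
      exact ⟨w, hw, fun _ _ => hw'⟩
    · obtain ⟨w, hw⟩ := hne x
      exact ⟨w, hw, fun h1 h2 => (hx ⟨h1, h2⟩).elim⟩
  choose f hfE hf using hfex
  refine ⟨fun _ x => PMF.pure (f x), ?_, ?_⟩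
  · intro h x y hy
    simp at hy
    rw [hy]; exact hfE x
  intro π1 hπ1
  have hπ0 : IsStrategy G (fun _ x => PMF.pure (f x)) := by
    intro h x y hy
    simp at hy
    rw [hy]; exact hfE x
  obtain ⟨hprob, hcyl⟩ := hRunM _ π1 hπ0 hπ1 v
  set P := RunM (fun _ x => PMF.pure (f x)) π1 v
  suffices hae : ∀ᵐ r ∂P, r ∈ parityEvent ℓ B by
    have : parityEvent ℓ B =ᵐ[P] Set.univ := Filter.eventuallyEq_univ.2 hae
    rw [measure_congr this, measure_univ]
  -- almost surely, all prefixes have positive probability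
  have hpos : ∀ᵐ r ∂P, ∀ l : List V,
      r ∈ cyl l → prefixProb G (fun _ x => PMF.pure (f x)) π1 v l ≠ 0 := by
    rw [ae_all_iff]
    intro l
    by_cases h0 : P (cyl l) = 0
    · filter_upwards [measure_eq_zero_iff_ae_notMem.1 h0] with r hr hr'
      exact (hr hr').elim
    · refine Filter.Eventually.of_forall fun r _ => ?_
      rwa [← hcyl l]
  have hnot : ∀ x ∈ G.Vr, x ∉ G.V0 ∧ x ∉ G.V1 := fun x hx =>
    ⟨fun h => Set.disjoint_left.1 d2 h hx, fun h => Set.disjoint_left.1 d3 h hx⟩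
  -- almost surely, the run is fair
  have hfair : ∀ᵐ r ∂P, ∀ u w, u ∈ G.Vr → w ∈ G.E u →
      {k | r k = u}.Infinite → {k | r k = u ∧ r (k+1) = w}.Infinite := by
    rw [ae_all_iff]; intro u
    rw [ae_all_iff]; intro w
    by_cases hu : u ∈ G.Vr
    · by_cases hw : w ∈ G.E u
      · have := fair_ae P u w (((G.E u).ncard : ℝ≥0∞)⁻¹) (by simp) (by
          intro h
          rw [hcyl, hcyl, prefixProb_append]
          simp [stepProb, (hnot u hu).1, (hnot u hu).2, hw])
        filter_upwards [this] with r hr _ _ using hr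
      · exact Filter.Eventually.of_forall fun r _ h => (hw h).elim
    · exact Filter.Eventually.of_forall fun r h => (hu h).elim
  filter_upwards [hpos, hfair] with r hr hrf
  have hr0 : r 0 = v := by
    have := hr [r 0] (by intro i; simp)
    by_contra hne
    simp [prefixProb, hne] at this
  have hstep : ∀ k, (r k ∈ G.V0 → r (k+1) = f (r k)) ∧ r (k+1) ∈ G.E (r k) := by
    intro k
    have := hr ((List.range k).map r ++ [r k, r (k+1)]) (by
      have := mem_cyl_map r (k+2)
      simpa [List.range_succ] using this)
    rw [prefixProb_append] at this
    have h2 := right_ne_zero_of_mul this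
    unfold stepProb at h2
    split_ifs at h2 with h3 h4 h5
    · have : r (k+1) = f (r k) := by
        by_contra hne
        simp [PMF.pure_apply, hne] at h2
      exact ⟨fun _ => this, this ▸ hfE _⟩
    · exact ⟨fun h => (h3 h).elim, hπ1 _ _ ((PMF.mem_support_iff _ _).2 h2)⟩
    · exact ⟨fun h => (h3 h).elim, h5⟩
    · exact (h2 rfl).elim
  have hcase : ∀ x, x ∈ G.V0 ∨ x ∈ G.V1 ∨ x ∈ G.Vr := by
    intro x
    have : x ∈ G.V0 ∪ G.V1 ∪ G.Vr := hcov ▸ Set.mem_univ x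
    rcases this with (h | h) | h
    · exact Or.inl h
    · exact Or.inr (Or.inl h)
    · exact Or.inr (Or.inr h)
  have hgood : ∀ k, r k ∈ S → r (k+1) ∈ S ∧
      ∀ i, col (r k) < i → ρ i (r (k+1)) ≤ ρ i (r k) := by
    intro k hk
    rcases hcase (r k) with h | h | h
    · rw [(hstep k).1 h]
      exact ⟨(hf _ hk h).1, (hf _ hk h).2.1⟩
    · have := (hcol _ hk).2.2.2.1 h _ (hstep k).2
      exact ⟨this.1, this.2.1⟩
    · exact ((hcol _ hk).2.2.2.2 h).1 _ (hstep k).2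
  have hS : ∀ k, r k ∈ S := by
    intro k
    induction k with
    | zero => rw [hr0]; exact hv
    | succ k ih => exact (hgood k ih).1
  refine parity_of_fair ℓ B hBdisj ρ r (fun k => col (r k))
    (fun k => ⟨(hcol _ (hS k)).1, (hcol _ (hS k)).2.1⟩) (fun k => (hgood k (hS k)).2) ?_
  intro i u hi1 hi2 hodd hu hinf
  obtain ⟨k0, hk0⟩ := hinf.nonempty
  have huS : u ∈ S := by
    have := hS k0
    rwa [show r k0 = u from hk0] at this
  have hci : col u = i := by
    by_contra hne
    exact Set.disjoint_left.1 (hBdisj _ (Finset.mem_Icc.2 (hcol u huS).1) i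
      (Finset.mem_Icc.2 ⟨hi1, hi2⟩) hne) (hcol u huS).2.1 hu
  rcases hcase u with h | h | h
  · refine hinf.mono fun k (hk : r k = u) => ⟨hk, ?_⟩
    rw [(hstep k).1 (by rw [hk]; exact h), hk]
    have := (hf u huS h).2.2
    rw [hci] at this
    exact this hodd
  · refine hinf.mono fun k (hk : r k = u) => ⟨hk, ?_⟩
    have h1 := (hstep k).2
    rw [hk] at h1
    have := ((hcol u huS).2.2.2.1 h _ h1).2.2
    rw [hci] at this
    exact this hodd
  · have := ((hcol u huS).2.2.2.2 h).2
    rw [hci] at this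
    obtain ⟨w, hw, hlt⟩ := this hodd
    refine (hrf u w h hw hinf).mono fun k hk => ⟨hk.1, ?_⟩
    rw [hk.2]; exact hlt
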